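/- arXiv:2110.06626 — 4 statements merged into one kernel-verified Lean document; each statement's English description precedes it below -/
import Mathlib

section
/- Let R be a left Noetherian ring and let α : X → Y be a chain map between bounded-below chain complexes of finitely generated projective left R-modules, each having bounded homology. If the mapping cone of α is homotopy equivalent to a bounded chain complex of finitely generated projective left R-modules, then there exists an integer l such that for every i ≥ l the cokernels Ω_i(X) and Ω_i(Y) are stably isomorphic, i.e. Ω_i(X) ⊕ P ≅ Ω_i(Y) ⊕ Q for some finitely generated projective left R-modules P and Q. -/
/-!
Chain complexes of modules, indexed by `ℤ`, with differential `d i : M i → M (i-1)`.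
-/

/-- A chain complex of `R`-modules. -/
structure Cpx (R : Type) [Ring R] where
  M : ℤ → Type
  [acg : ∀ i, AddCommGroup (M i)]
  [mod : ∀ i, Module R (M i)]
  d : ∀ i : ℤ, M i →ₗ[R] M (i - 1)
  dd : ∀ i : ℤ, (d (i - 1)).comp (d i) = 0

attribute [instance] Cpx.acg Cpx.mod

variable {R : Type} [Ring R]

/-- A chain map between chain complexes. -/
structure ChainMap (C D : Cpx R) where
  f : ∀ i : ℤ, C.M i →ₗ[R] D.M i
  comm : ∀ i : ℤ, (f (i - 1)).comp (C.d i) = (D.d i).comp (f i)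

/-- The identity chain map. -/
def ChainMap.id (C : Cpx R) : ChainMap C C :=
  ⟨fun _ => LinearMap.id, fun _ => rfl⟩

/-- Composition of chain maps. -/
def ChainMap.comp {C D E : Cpx R} (g : ChainMap D E) (f : ChainMap C D) : ChainMap C E where
  f i := (g.f i).comp (f.f i)
  comm i := by
    rw [LinearMap.comp_assoc, f.comm i, ← LinearMap.comp_assoc, g.comm i, LinearMap.comp_assoc]

/-- Two chain maps are homotopic if they differ by `d ∘ σ + σ ∘ d`. -/
def Homotopic {C D : Cpx R} (f g : ChainMap C D) : Prop :=
  ∃ σ : ∀ i : ℤ, C.M (i - 1) →ₗ[R] D.M i,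
    ∀ i : ℤ, f.f (i - 1) - g.f (i - 1) = (D.d i).comp (σ i) + (σ (i - 1)).comp (C.d (i - 1))

/-- A chain map is a homotopy equivalence if it has a homotopy inverse. -/
def IsHomotopyEquiv {C D : Cpx R} (φ : ChainMap C D) : Prop :=
  ∃ ψ : ChainMap D C,
    Homotopic (ψ.comp φ) (ChainMap.id C) ∧ Homotopic (φ.comp ψ) (ChainMap.id D)

/-- `Ω_i(C)`, the cokernel of `d (i+1) : C.M (i+1) → C.M i`. -/
def Omega (C : Cpx R) (i : ℤ) : Type :=
  C.M (i + 1 - 1) ⧸ LinearMap.range (C.d (i + 1))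

noncomputable instance (C : Cpx R) (i : ℤ) : AddCommGroup (Omega C i) :=
  inferInstanceAs (AddCommGroup (C.M (i + 1 - 1) ⧸ LinearMap.range (C.d (i + 1))))

noncomputable instance (C : Cpx R) (i : ℤ) : Module R (Omega C i) :=
  inferInstanceAs (Module R (C.M (i + 1 - 1) ⧸ LinearMap.range (C.d (i + 1))))

/-- `A` and `B` are stably isomorphic: `A ⊕ P ≅ B ⊕ Q` for some finitely generated
projective modules `P` and `Q`. -/
def StablyIso (R : Type) [Ring R] (A B : Type) [AddCommGroup A] [Module R A]
    [AddCommGroup B] [Module R B] : Prop :=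
  ∃ P Q : ModuleCat.{0} R,
    Module.Finite R P ∧ Module.Projective R P ∧
    Module.Finite R Q ∧ Module.Projective R Q ∧
    Nonempty ((A × P) ≃ₗ[R] (B × Q))

/-- The mapping cone of a chain map `α : X → Y`:
`Cone(α)_i = Y_i ⊕ X_{i-1}` with differential `(y, x) ↦ (d y + α x, - d x)`. -/
def cone {X Y : Cpx R} (α : ChainMap X Y) : Cpx R where
  M i := Y.M i × X.M (i - 1)
  d i := LinearMap.prod
    (((Y.d i).comp (LinearMap.fst R (Y.M i) (X.M (i - 1)))) +
      ((α.f (i - 1)).comp (LinearMap.snd R (Y.M i) (X.M (i - 1)))))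
    (-((X.d (i - 1)).comp (LinearMap.snd R (Y.M i) (X.M (i - 1)))))
  dd i := by
    apply LinearMap.ext
    rintro ⟨y, x⟩
    have h1 := LinearMap.ext_iff.1 (Y.dd i) y
    have h2 := LinearMap.ext_iff.1 (X.dd (i - 1)) x
    have h3 := LinearMap.ext_iff.1 (α.comm (i - 1)) x
    simp only [LinearMap.comp_apply, LinearMap.zero_apply, LinearMap.prod_apply, Pi.prod,
      LinearMap.add_apply, LinearMap.neg_apply, LinearMap.fst_apply, LinearMap.snd_apply,
      map_add, map_neg, Prod.mk_add_mk, Prod.neg_mk] at *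
    refine Prod.ext ?_ ?_ <;> simp [h1, h2, h3, Prod.fst, Prod.snd]

/-- If `f : A → B` and `g : B → A` are mutually inverse up to maps factoring through finitely
generated projective modules `P` and `P'`, then `A` and `B` are stably isomorphic. -/
theorem StablyIso.of_inverse_modulo_projective {A B P P' : Type}
    [AddCommGroup A] [Module R A] [AddCommGroup B] [Module R B]
    [AddCommGroup P] [Module R P] [AddCommGroup P'] [Module R P']
    [Module.Finite R P] [Module.Projective R P] [Module.Finite R P'] [Module.Projective R P']
    (f : A →ₗ[R] B) (g : B →ₗ[R] A) (d : A →ₗ[R] P) (t : P →ₗ[R] A)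
    (v : B →ₗ[R] P') (u : P' →ₗ[R] B)
    (hgf : ∀ a, g (f a) = a + t (d a)) (hfg : ∀ b, f (g b) = b + u (v b)) :
    StablyIso R A B := by
  let ι : A →ₗ[R] B × P := f.prod d
  let π : B × P →ₗ[R] A := g.coprod (-t)
  have hπι : ∀ a, π (ι a) = a := fun a => by simp [ι, π, hgf]
  let e : B × P →ₗ[R] LinearMap.ker π :=
    (LinearMap.id - ι ∘ₗ π).codRestrict _ fun z => by simp [hπι]
  have he : ∀ q : LinearMap.ker π, e q = q := fun q => by
    apply Subtype.ext
    have hq : π q = 0 := q.2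
    simp [e, hq]
  -- The idempotent `1 - ι ∘ π` factors through `P' × P × P`.
  let a : B × P →ₗ[R] P' × P × P :=
    (v ∘ₗ LinearMap.fst R B P).prod
      ((LinearMap.snd R B P).prod (LinearMap.snd R B P - d ∘ₗ π))
  let b : P' × P × P →ₗ[R] B × P :=
    ((-u).coprod ((f ∘ₗ t).coprod 0)).prod
      (LinearMap.snd R P P ∘ₗ LinearMap.snd R P' (P × P))
  have hba : ∀ z, b (a z) = z - ι (π z) := by
    rintro ⟨y, p⟩
    ext
    · simp [a, b, ι, π, hfg]
      abel
    · simp [a, b, ι, π]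
  have hsplit : (e ∘ₗ b) ∘ₗ (a ∘ₗ (LinearMap.ker π).subtype) = LinearMap.id := by
    ext1 q
    have hq : π q = 0 := q.2
    have hb : b (a q) = q := by rw [hba, hq, map_zero, sub_zero]
    simp only [LinearMap.comp_apply, Submodule.subtype_apply, LinearMap.id_apply, hb, he]
  have hproj : Module.Projective R (LinearMap.ker π) := Module.Projective.of_split _ _ hsplit
  have hfin : Module.Finite R (LinearMap.ker π) :=
    Module.Finite.of_surjective (e ∘ₗ b) fun q => ⟨_, LinearMap.congr_fun hsplit q⟩
  refine ⟨ModuleCat.of R (LinearMap.ker π), ModuleCat.of R P, hfin, hproj, ‹_›, ‹_›, ⟨?_⟩⟩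
  refine LinearEquiv.ofLinearMap (ι.coprod (LinearMap.ker π).subtype) (π.prod e) ?_ ?_
  · apply LinearMap.ext
    intro z
    simp [e]
  · apply LinearMap.ext
    rintro ⟨x, q⟩
    have hq : π q = 0 := q.2
    refine Prod.ext ?_ (Subtype.ext ?_)
    · simp [hπι, hq]
    · simp [e, hπι, hq]

/-- If the mapping cone of `α` admits a contraction `σ` (up to sign) in degrees at least `m - 1`,
then the cokernels of the differentials out of degree `m` are stably isomorphic. -/
theorem stablyIso_coker_of_cone_contraction {X Y : Cpx R} (α : ChainMap X Y)
    (hXfg : ∀ i, Module.Finite R (X.M i)) (hXproj : ∀ i, Module.Projective R (X.M i))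
    (hYfg : ∀ i, Module.Finite R (Y.M i)) (hYproj : ∀ i, Module.Projective R (Y.M i))
    (σ : ∀ i : ℤ, (cone α).M (i - 1) →ₗ[R] (cone α).M i) (m : ℤ)
    (hσ : ∀ k, m ≤ k → ∀ z, (cone α).d k (σ k z) + σ (k - 1) ((cone α).d (k - 1) z) = -z) :
    StablyIso R (X.M (m - 1) ⧸ LinearMap.range (X.d m))
      (Y.M (m - 1) ⧸ LinearMap.range (Y.d m)) := by
  obtain ⟨k, rfl⟩ : ∃ k, m = k - 1 := ⟨m + 1, by ring⟩
  let inY (i : ℤ) : Y.M i →ₗ[R] (cone α).M i := LinearMap.inl R (Y.M i) (X.M (i - 1))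
  let inX (i : ℤ) : X.M (i - 1) →ₗ[R] (cone α).M i := LinearMap.inr R (Y.M i) (X.M (i - 1))
  let prY (i : ℤ) : (cone α).M i →ₗ[R] Y.M i := LinearMap.fst R (Y.M i) (X.M (i - 1))
  let prX (i : ℤ) : (cone α).M i →ₗ[R] X.M (i - 1) := LinearMap.snd R (Y.M i) (X.M (i - 1))
  have hprY (i : ℤ) (z) : prY (i - 1) ((cone α).d i z) =
      Y.d i (prY i z) + α.f (i - 1) (prX i z) := rfl
  have hprX (i : ℤ) (z) : prX (i - 1) ((cone α).d i z) = -X.d (i - 1) (prX i z) := rfl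
  have hinY (i : ℤ) (y) : (cone α).d i (inY i y) = inY (i - 1) (Y.d i y) := by
    refine Prod.ext ?_ ?_
    · change Y.d i y + α.f (i - 1) 0 = Y.d i y
      simp
    · change -X.d (i - 1) 0 = 0
      simp
  have hinX (i : ℤ) (x) : (cone α).d i (inX i x) =
      inY (i - 1) (α.f (i - 1) x) - inX (i - 1) (X.d (i - 1) x) := by
    refine Prod.ext ?_ ?_
    · change Y.d i 0 + α.f (i - 1) x = α.f (i - 1) x - 0
      simp
    · change -X.d (i - 1) x = 0 - X.d (i - 1) x
      simp
  let r (i : ℤ) : Y.M (i - 1) →ₗ[R] X.M (i - 1) := prX i ∘ₗ σ i ∘ₗ inY (i - 1)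
  have hr (y : Y.M (k - 1)) : r (k - 1) (Y.d (k - 1) y) = X.d (k - 1) (r k y) := by
    have h := congrArg (prX (k - 1)) (hσ k (by omega) (inY (k - 1) y))
    rw [map_add, hprX, hinY, map_neg] at h
    have h0 : prX (k - 1) (inY (k - 1) y) = 0 := rfl
    rw [h0, neg_zero, neg_add_eq_zero] at h
    exact h.symm
  have hαr (y : Y.M (k - 1 - 1)) :
      Y.d (k - 1) (prY _ (σ (k - 1) (inY _ y))) + α.f _ (r (k - 1) y) +
        prY _ (σ (k - 1 - 1) (inY _ (Y.d (k - 1 - 1) y))) = -y := by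
    have h := congrArg (prY (k - 1 - 1)) (hσ (k - 1) le_rfl (inY _ y))
    rw [map_add, hprY, hinY, map_neg] at h
    exact h
  have hrα (x : X.M (k - 1 - 1)) :
      -X.d (k - 1) (prX _ (σ k (inX _ x))) + (r (k - 1) (α.f _ x) -
        prX _ (σ (k - 1) (inX _ (X.d (k - 1 - 1) x)))) = -x := by
    have h := congrArg (prX (k - 1)) (hσ k (by omega) (inX _ x))
    rw [map_add, hprX, hinX, map_sub, map_sub, map_neg] at h
    exact h
  have := hXfg (k - 1 - 1 - 1)
  have := hXproj (k - 1 - 1 - 1)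
  have := hYfg (k - 1 - 1 - 1)
  have := hYproj (k - 1 - 1 - 1)
  have hrange (C : Cpx R) (i : ℤ) (x) : (LinearMap.range (C.d i)).mkQ (C.d i x) = 0 := by
    simp
  refine StablyIso.of_inverse_modulo_projective
    (Submodule.mapQ _ _ (α.f (k - 1 - 1)) ?_)
    (Submodule.mapQ _ _ (-r (k - 1)) ?_)
    (Submodule.liftQ _ (X.d (k - 1 - 1)) ?_)
    (-((LinearMap.range (X.d (k - 1))).mkQ ∘ₗ prX _ ∘ₗ σ (k - 1) ∘ₗ inX _))
    (Submodule.liftQ _ (Y.d (k - 1 - 1)) ?_)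
    ((LinearMap.range (Y.d (k - 1))).mkQ ∘ₗ prY _ ∘ₗ σ (k - 1 - 1) ∘ₗ inY _) ?_ ?_
  · rintro _ ⟨x, rfl⟩
    exact ⟨α.f _ x, (LinearMap.congr_fun (α.comm (k - 1)) x).symm⟩
  · rintro _ ⟨y, rfl⟩
    exact ⟨-r k y, by rw [map_neg, ← hr]; rfl⟩
  · rintro _ ⟨x, rfl⟩
    exact LinearMap.congr_fun (X.dd (k - 1)) x
  · rintro _ ⟨y, rfl⟩
    exact LinearMap.congr_fun (Y.dd (k - 1)) y
  · intro a
    obtain ⟨x, rfl⟩ := Submodule.mkQ_surjective _ a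
    have h := congrArg (LinearMap.range (X.d (k - 1))).mkQ (hrα x)
    simp only [map_add, map_sub, map_neg, hrange, neg_zero, zero_add] at h
    change (LinearMap.range (X.d (k - 1))).mkQ (-r (k - 1) (α.f _ x)) =
      (LinearMap.range (X.d (k - 1))).mkQ x + -(LinearMap.range (X.d (k - 1))).mkQ
        (prX _ (σ (k - 1) (inX _ (X.d (k - 1 - 1) x))))
    rw [map_neg, sub_eq_iff_eq_add.1 h]
    abel
  · intro b
    obtain ⟨y, rfl⟩ := Submodule.mkQ_surjective _ b
    have h := congrArg (LinearMap.range (Y.d (k - 1))).mkQ (hαr y)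
    simp only [map_add, map_neg, hrange, zero_add] at h
    change (LinearMap.range (Y.d (k - 1))).mkQ (α.f _ (-r (k - 1) y)) =
      (LinearMap.range (Y.d (k - 1))).mkQ y + (LinearMap.range (Y.d (k - 1))).mkQ
        (prY _ (σ (k - 1 - 1) (inY _ (Y.d (k - 1 - 1) y))))
    rw [map_neg, map_neg, eq_sub_of_add_eq h]
    abel

theorem statement_0 (R : Type) [Ring R] [IsNoetherianRing R]
    (X Y : Cpx R) (α : ChainMap X Y)
    (hXfg : ∀ i, Module.Finite R (X.M i)) (hXproj : ∀ i, Module.Projective R (X.M i))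
    (hYfg : ∀ i, Module.Finite R (Y.M i)) (hYproj : ∀ i, Module.Projective R (Y.M i))
    (hXbb : ∃ n : ℤ, ∀ i < n, Subsingleton (X.M i))
    (hYbb : ∃ n : ℤ, ∀ i < n, Subsingleton (Y.M i))
    (hXbh : ∃ a b : ℤ, ∀ i : ℤ, (i - 1 < a ∨ b < i - 1) →
      LinearMap.ker (X.d (i - 1)) ≤ LinearMap.range (X.d i))
    (hYbh : ∃ a b : ℤ, ∀ i : ℤ, (i - 1 < a ∨ b < i - 1) →
      LinearMap.ker (Y.d (i - 1)) ≤ LinearMap.range (Y.d i))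
    (hcone : ∃ B : Cpx R,
      (∀ i, Module.Finite R (B.M i)) ∧ (∀ i, Module.Projective R (B.M i)) ∧
      (∃ a b : ℤ, ∀ i : ℤ, (i < a ∨ b < i) → Subsingleton (B.M i)) ∧
      ∃ φ : ChainMap (cone α) B, IsHomotopyEquiv φ) :
    ∃ l : ℤ, ∀ i : ℤ, l ≤ i → StablyIso R (Omega X i) (Omega Y i) := by
  obtain ⟨B, -, -, ⟨_, b, hB⟩, φ, ψ, ⟨σ, hσ⟩, -⟩ := hcone
  refine ⟨b + 1, fun i hi => ?_⟩
  refine stablyIso_coker_of_cone_contraction α hXfg hXproj hYfg hYproj σ (i + 1) fun k hk z => ?_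
  have := hB (k - 1) (Or.inr (by omega))
  have h := LinearMap.congr_fun (hσ k) z
  have h0 : (ψ.comp φ).f (k - 1) z = 0 := by
    change ψ.f (k - 1) (φ.f (k - 1) z) = 0
    rw [Subsingleton.elim (φ.f (k - 1) z) 0, map_zero]
  rw [LinearMap.sub_apply, h0, zero_sub] at h
  exact h.symm
end

section
/- Let R be a left Noetherian ring and let φ : X → Y be a homotopy equivalence between bounded-below chain complexes of finitely generated projective left R-modules. Then for every integer i the cokernels Ω_i(X) and Ω_i(Y) are stably isomorphic, i.e. Ω_i(X) ⊕ P ≅ Ω_i(Y) ⊕ Q for some finitely generated projective left R-modules P and Q. -/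
variable {R : Type} [Ring R]

/-- If `f : A → B` and `g : B → A` are mutually inverse up to maps that factor through finitely
generated projective modules, then `A` and `B` are stably isomorphic. -/
theorem StablyIso.of_comp_sub_id_factors {A B P Q : Type}
    [AddCommGroup A] [Module R A] [AddCommGroup B] [Module R B]
    [AddCommGroup P] [Module R P] [AddCommGroup Q] [Module R Q]
    [Module.Finite R P] [Module.Projective R P] [Module.Finite R Q] [Module.Projective R Q]
    (f : A →ₗ[R] B) (g : B →ₗ[R] A)
    (p : A →ₗ[R] P) (s : P →ₗ[R] A) (q : B →ₗ[R] Q) (t : Q →ₗ[R] B)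
    (hgf : ∀ a, g (f a) - a = s (p a)) (hfg : ∀ b, f (g b) - b = t (q b)) :
    StablyIso R A B := by
  let F : A →ₗ[R] B × P := f.prod p
  let G : B × P →ₗ[R] A := g.coprod (-s)
  have hGF (a : A) : G (F a) = a := by
    simp [F, G, ← hgf]
  let K := LinearMap.ker G
  let r : B × P →ₗ[R] K := (LinearMap.id - F.comp G).codRestrict K fun z => by
    simp [K, hGF]
  have hr (z : B × P) : (r z : B × P) = z - F (G z) := rfl
  have hrK (k : K) : r k = k := by
    apply Subtype.ext
    rw [hr, LinearMap.mem_ker.mp k.2, map_zero, sub_zero]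
  -- The projection `r` onto `K` factors through `Q × P × P`, so `K` is a retract of it.
  let α : B × P →ₗ[R] Q × P × P :=
    (q.comp (.fst R B P)).prod ((LinearMap.snd R B P).prod ((p.comp g).comp (.fst R B P)))
  let β : Q × P × P →ₗ[R] B × P :=
    ((-t).coprod ((f.comp s).coprod 0)).prod
      ((0 : Q →ₗ[R] P).coprod ((LinearMap.id + p.comp s).coprod (-LinearMap.id)))
  have hβα (z : B × P) : β (α z) = z - F (G z) := by
    ext
    · simp [α, β, F, G, ← hfg]
      abel
    · simp [α, β, F, G]
      abel
  have hsplit : (r.comp β).comp (α.comp K.subtype) = LinearMap.id := by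
    ext1 k
    change r (β (α k)) = k
    rw [hβα, ← hr, hrK, hrK]
  refine ⟨ModuleCat.of R K, ModuleCat.of R P,
    Module.Finite.of_surjective (r.comp β)
      (LinearMap.surjective_of_comp_eq_id _ _ hsplit),
    Module.Projective.of_split _ _ hsplit, inferInstance, inferInstance, ⟨?_⟩⟩
  refine LinearEquiv.ofLinearMap (F.coprod K.subtype) (G.prod r) ?_ ?_
  · refine LinearMap.ext fun z => ?_
    change F (G z) + (r z : B × P) = z
    rw [hr, add_sub_cancel]
  · refine LinearMap.ext fun ⟨a, k⟩ => ?_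
    change (G (F a + k), r (F a + k)) = (a, k)
    have hrF : r (F a) = 0 := Subtype.ext (by rw [hr, hGF, sub_self]; rfl)
    rw [map_add, map_add, hGF, hrF, hrK, LinearMap.mem_ker.mp k.2, add_zero, zero_add]

/-- The map induced by a chain map on cokernels of differentials. -/
noncomputable def ChainMap.omegaMap {C D : Cpx R} (φ : ChainMap C D) (i : ℤ) :
    Omega C i →ₗ[R] Omega D i :=
  Submodule.mapQ _ _ (φ.f (i + 1 - 1)) <| by
    rintro _ ⟨x, rfl⟩
    exact ⟨φ.f (i + 1) x, (LinearMap.congr_fun (φ.comm (i + 1)) x).symm⟩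

/-- The map `Ω_i(C) → C_{i-1}` induced by the differential. -/
noncomputable def Cpx.omegaD (C : Cpx R) (i : ℤ) : Omega C i →ₗ[R] C.M (i + 1 - 1 - 1) :=
  Submodule.liftQ _ (C.d (i + 1 - 1)) <| by
    rintro _ ⟨x, rfl⟩
    exact LinearMap.congr_fun (C.dd (i + 1)) x

/-- If `ψ ∘ φ` is homotopic to the identity, then on `Ω_i(C)` it differs from the identity by a map
that factors through the differential. -/
theorem Homotopic.exists_omegaMap_sub_eq {C D : Cpx R} {φ : ChainMap C D} {ψ : ChainMap D C}
    (h : Homotopic (ψ.comp φ) (ChainMap.id C)) (i : ℤ) :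
    ∃ s : C.M (i + 1 - 1 - 1) →ₗ[R] Omega C i,
      ∀ a, ψ.omegaMap i (φ.omegaMap i a) - a = s (C.omegaD i a) := by
  obtain ⟨σ, hσ⟩ := h
  refine ⟨(Submodule.mkQ (LinearMap.range (C.d (i + 1)))).comp (σ (i + 1 - 1)), fun a => ?_⟩
  obtain ⟨x, rfl⟩ := Submodule.mkQ_surjective (LinearMap.range (C.d (i + 1))) a
  have hx : ψ.f (i + 1 - 1) (φ.f (i + 1 - 1) x) - x =
      C.d (i + 1) (σ (i + 1) x) + σ (i + 1 - 1) (C.d (i + 1 - 1) x) :=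
    LinearMap.congr_fun (hσ (i + 1)) x
  refine (Submodule.Quotient.eq (LinearMap.range (C.d (i + 1)))
    (x := ψ.f (i + 1 - 1) (φ.f (i + 1 - 1) x) - x)
    (y := σ (i + 1 - 1) (C.d (i + 1 - 1) x))).mpr ?_
  exact ⟨σ (i + 1) x, eq_sub_of_add_eq hx.symm⟩

theorem statement_1 (R : Type) [Ring R] [IsNoetherianRing R]
    (X Y : Cpx R)
    (hXfg : ∀ i, Module.Finite R (X.M i)) (hXproj : ∀ i, Module.Projective R (X.M i))
    (hYfg : ∀ i, Module.Finite R (Y.M i)) (hYproj : ∀ i, Module.Projective R (Y.M i))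
    (hXbb : ∃ n : ℤ, ∀ i < n, Subsingleton (X.M i))
    (hYbb : ∃ n : ℤ, ∀ i < n, Subsingleton (Y.M i))
    (φ : ChainMap X Y) (hφ : IsHomotopyEquiv φ) :
    ∀ i : ℤ, StablyIso R (Omega X i) (Omega Y i) := by
  intro i
  obtain ⟨ψ, hψφ, hφψ⟩ := hφ
  obtain ⟨s, hs⟩ := hψφ.exists_omegaMap_sub_eq i
  obtain ⟨t, ht⟩ := hφψ.exists_omegaMap_sub_eq i
  have := hXfg (i + 1 - 1 - 1)
  have := hXproj (i + 1 - 1 - 1)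
  have := hYfg (i + 1 - 1 - 1)
  have := hYproj (i + 1 - 1 - 1)
  exact StablyIso.of_comp_sub_id_factors (φ.omegaMap i) (ψ.omegaMap i)
    (X.omegaD i) s (Y.omegaD i) t hs ht
end

section
/- Let R be a left Noetherian ring and let X be a bounded-below chain complex of finitely generated projective left R-modules that is homotopy equivalent to a bounded chain complex of finitely generated projective left R-modules. Then there exists an integer r₀ such that the cokernel Ω_r(X) = coker(d_{r+1} : X_{r+1} → X_r) is a projective R-module for every r ≥ r₀. -/
variable {R : Type} [Ring R]

/-- If `-1 = d s + t e` on the middle term of `N → M → P`, where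
`e d = 0`, then the cokernel of `d` is a direct summand of `M`, hence projective if `M` is. -/
theorem projective_quotient_range_of_contraction {R N M P : Type*} [Ring R]
    [AddCommGroup N] [Module R N] [AddCommGroup M] [Module R M] [AddCommGroup P]
    [Module R P] [Module.Projective R M] (d : N →ₗ[R] M) (e : M →ₗ[R] P)
    (hd : e.comp d = 0) (s : M →ₗ[R] N) (t : P →ₗ[R] M)
    (h : -LinearMap.id = d.comp s + t.comp e) :
    Module.Projective R (M ⧸ LinearMap.range d) := by
  have hker : LinearMap.range d ≤ LinearMap.ker (-(t.comp e)) := by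
    rintro _ ⟨x, rfl⟩
    have hx : e (d x) = 0 := LinearMap.congr_fun hd x
    simp [hx]
  refine Module.Projective.of_split ((LinearMap.range d).liftQ _ hker) (LinearMap.range d).mkQ ?_
  ext x
  have hx : -x = d (s x) + t (e x) := LinearMap.congr_fun h x
  change (LinearMap.range d).mkQ (-(t (e x))) = (LinearMap.range d).mkQ x
  rw [← sub_eq_zero, ← map_sub, Submodule.mkQ_apply, Submodule.Quotient.mk_eq_zero]
  exact ⟨s x, by rw [eq_sub_of_add_eq hx.symm]; abel⟩

theorem statement_2 (R : Type) [Ring R] [IsNoetherianRing R]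
    (X : Cpx R)
    (hXfg : ∀ i, Module.Finite R (X.M i)) (hXproj : ∀ i, Module.Projective R (X.M i))
    (hXbb : ∃ n : ℤ, ∀ i < n, Subsingleton (X.M i))
    (B : Cpx R)
    (hBfg : ∀ i, Module.Finite R (B.M i)) (hBproj : ∀ i, Module.Projective R (B.M i))
    (hBbdd : ∃ a b : ℤ, ∀ i : ℤ, (i < a ∨ b < i) → Subsingleton (B.M i))
    (φ : ChainMap X B) (hφ : IsHomotopyEquiv φ) :
    ∃ r₀ : ℤ, ∀ r : ℤ, r₀ ≤ r → Module.Projective R (Omega X r) := by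
  obtain ⟨_, b, hb⟩ := hBbdd
  obtain ⟨ψ, ⟨σ, hσ⟩, -⟩ := hφ
  refine ⟨b + 1, fun r hr => ?_⟩
  have := hXproj (r + 1 - 1)
  have := hb (r + 1 - 1) (Or.inr (by omega))
  refine projective_quotient_range_of_contraction (X.d (r + 1)) (X.d (r + 1 - 1)) (X.dd (r + 1))
    (σ (r + 1)) (σ (r + 1 - 1)) ?_
  rw [← hσ (r + 1)]
  ext x
  have hx : φ.f (r + 1 - 1) x = 0 := Subsingleton.elim _ _
  simp [ChainMap.comp, ChainMap.id, hx]
end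

section
/- Let R be a left artin ring and M a finitely generated left R-module such that Ω_R^m(M) is nonzero and periodic of period q for some m ≥ 0. If there exist integers j ≥ 0 and p > 0 with Ω_R^{j+p}(M) ≅ Ω_R^j(M), then q divides p. -/
/-- `p : P → M` is a projective cover: `P` is finitely generated projective, `p` is
surjective and `ker p` is superfluous in `P`. -/
def IsProjCover (S : Type) [Ring S] {P M : Type} [AddCommGroup P] [Module S P]
    [AddCommGroup M] [Module S M] (p : P →ₗ[S] M) : Prop :=
  Module.Finite S P ∧ Module.Projective S P ∧ Function.Surjective p ∧
    ∀ L : Submodule S P, L ⊔ LinearMap.ker p = ⊤ → L = ⊤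

/-- `Z` is a syzygy of `M`: the kernel of a projective cover of `M`. -/
def IsSyzygyOf (S : Type) [Ring S] (Z M : ModuleCat.{0} S) : Prop :=
  ∃ (P : ModuleCat.{0} S) (p : P →ₗ[S] M),
    IsProjCover S p ∧ Nonempty (Z ≃ₗ[S] LinearMap.ker p)

/-- `Z` is an `n`-th syzygy of `M` (with respect to projective covers). -/
def IsNthSyzygyOf (S : Type) [Ring S] : ℕ → ModuleCat.{0} S → ModuleCat.{0} S → Prop
  | 0, Z, M => Nonempty (Z ≃ₗ[S] M)
  | n + 1, Z, M => ∃ W : ModuleCat.{0} S, IsNthSyzygyOf S n W M ∧ IsSyzygyOf S Z W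

/-- `X` is periodic of period `p`: `Ω^p(X) ≅ X` and `p` is the least positive
integer with this property. -/
def IsPeriodicWithPeriod (S : Type) [Ring S] (X : ModuleCat.{0} S) (p : ℕ) : Prop :=
  0 < p ∧ (∃ Z, IsNthSyzygyOf S p Z X ∧ Nonempty (Z ≃ₗ[S] X)) ∧
    ∀ q : ℕ, 0 < q → (∃ Z, IsNthSyzygyOf S q Z X ∧ Nonempty (Z ≃ₗ[S] X)) → p ≤ q

/-- Projective covers of isomorphic modules have isomorphic kernels. -/
theorem IsProjCover.nonempty_ker_equiv {S : Type} [Ring S] {P P' M M' : Type}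
    [AddCommGroup P] [Module S P] [AddCommGroup M] [Module S M]
    [AddCommGroup P'] [Module S P'] [AddCommGroup M'] [Module S M']
    {p : P →ₗ[S] M} {p' : P' →ₗ[S] M'} (hp : IsProjCover S p) (hp' : IsProjCover S p')
    (e : M ≃ₗ[S] M') : Nonempty (LinearMap.ker p ≃ₗ[S] LinearMap.ker p') := by
  obtain ⟨-, hproj, hsurj, hsup⟩ := hp
  obtain ⟨-, hproj', hsurj', hsup'⟩ := hp'
  obtain ⟨f, hf⟩ := Module.projective_lifting_property p' (e.toLinearMap ∘ₗ p) hsurj'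
  have hf' (x : P) : p' (f x) = e (p x) := LinearMap.congr_fun hf x
  have hfr : LinearMap.range f = ⊤ := by
    refine hsup' _ (eq_top_iff.2 fun y _ => ?_)
    obtain ⟨x, hx⟩ := hsurj (e.symm (p' y))
    refine Submodule.mem_sup.2 ⟨f x, ⟨x, rfl⟩, y - f x, ?_, by abel⟩
    simp [hf', hx]
  have hfs : Function.Surjective f := LinearMap.range_eq_top.1 hfr
  obtain ⟨g, hg⟩ := Module.projective_lifting_property f LinearMap.id hfs
  have hg' (y : P') : f (g y) = y := LinearMap.congr_fun hg y
  have hgr : LinearMap.range g = ⊤ := by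
    refine hsup _ (eq_top_iff.2 fun x _ => ?_)
    refine Submodule.mem_sup.2 ⟨g (f x), ⟨f x, rfl⟩, x - g (f x), ?_, by abel⟩
    rw [LinearMap.mem_ker, ← e.map_eq_zero_iff, ← hf', map_sub, hg', sub_self, map_zero]
  have hfi : Function.Injective f :=
    (Function.LeftInverse.rightInverse_of_surjective (f := f) (g := g) hg'
      (LinearMap.range_eq_top.1 hgr)).injective
  refine ⟨LinearEquiv.ofSubmodules (LinearEquiv.ofBijective f ⟨hfi, hfs⟩) _ _ ?_⟩
  ext y
  constructor
  · rintro ⟨x, hx, rfl⟩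
    have hx' : p x = 0 := hx
    change p' (f x) = 0
    rw [hf', hx', map_zero]
  · intro hy
    obtain ⟨x, rfl⟩ := hfs y
    refine ⟨x, ?_, rfl⟩
    have hy' : p' (f x) = 0 := hy
    simpa [hf'] using hy'

/-- Syzygies of isomorphic modules are isomorphic. -/
theorem IsSyzygyOf.nonempty_equiv {S : Type} [Ring S] {Z Z' M M' : ModuleCat.{0} S}
    (h : IsSyzygyOf S Z M) (h' : IsSyzygyOf S Z' M') (e : Nonempty (M ≃ₗ[S] M')) :
    Nonempty (Z ≃ₗ[S] Z') := by
  obtain ⟨P, p, hp, ⟨a⟩⟩ := h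
  obtain ⟨P', p', hp', ⟨a'⟩⟩ := h'
  obtain ⟨e⟩ := e
  obtain ⟨k⟩ := hp.nonempty_ker_equiv hp' e
  exact ⟨a.trans (k.trans a'.symm)⟩

/-- Being a syzygy is invariant under isomorphism of the syzygy. -/
theorem IsSyzygyOf.of_equiv {S : Type} [Ring S] {Z Z' M : ModuleCat.{0} S}
    (h : IsSyzygyOf S Z M) (e : Nonempty (Z ≃ₗ[S] Z')) : IsSyzygyOf S Z' M := by
  obtain ⟨P, p, hp, ⟨a⟩⟩ := h
  obtain ⟨e⟩ := e
  exact ⟨P, p, hp, ⟨e.symm.trans a⟩⟩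

namespace IsNthSyzygyOf

variable {S : Type} [Ring S]

/-- The `n`-th syzygies of isomorphic modules are isomorphic. -/
theorem nonempty_equiv {n : ℕ} {Z Z' M M' : ModuleCat.{0} S}
    (h : IsNthSyzygyOf S n Z M) (h' : IsNthSyzygyOf S n Z' M')
    (e : Nonempty (M ≃ₗ[S] M')) : Nonempty (Z ≃ₗ[S] Z') := by
  induction n generalizing Z Z' with
  | zero =>
    obtain ⟨a⟩ := h
    obtain ⟨a'⟩ := h'
    obtain ⟨e⟩ := e
    exact ⟨a.trans (e.trans a'.symm)⟩
  | succ n ih =>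
    obtain ⟨W, hW, hZ⟩ := h
    obtain ⟨W', hW', hZ'⟩ := h'
    exact hZ.nonempty_equiv hZ' (ih hW hW')

/-- Being an `n`-th syzygy is invariant under isomorphism of the syzygy. -/
theorem of_equiv {n : ℕ} {Z Z' M : ModuleCat.{0} S}
    (h : IsNthSyzygyOf S n Z M) (e : Nonempty (Z ≃ₗ[S] Z')) : IsNthSyzygyOf S n Z' M := by
  cases n with
  | zero =>
    obtain ⟨a⟩ := h
    obtain ⟨e⟩ := e
    exact ⟨e.symm.trans a⟩
  | succ n =>
    obtain ⟨W, hW, hZ⟩ := h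
    exact ⟨W, hW, hZ.of_equiv e⟩

/-- An `(a + b)`-th syzygy is the same as a `b`-th syzygy of an `a`-th syzygy. -/
theorem add_iff {a b : ℕ} {Z M : ModuleCat.{0} S} :
    IsNthSyzygyOf S (a + b) Z M ↔
      ∃ W, IsNthSyzygyOf S a W M ∧ IsNthSyzygyOf S b Z W := by
  induction b generalizing Z with
  | zero =>
    constructor
    · exact fun h => ⟨Z, h, ⟨LinearEquiv.refl S Z⟩⟩
    · rintro ⟨W, hW, ⟨e⟩⟩
      exact hW.of_equiv ⟨e.symm⟩
  | succ b ih =>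
    constructor
    · rintro ⟨V, hV, hZ⟩
      obtain ⟨W, hW, hVW⟩ := ih.1 hV
      exact ⟨W, hW, V, hVW, hZ⟩
    · rintro ⟨W, hW, V, hVW, hZ⟩
      exact ⟨V, ih.2 ⟨W, hW, hVW⟩, hZ⟩

/-- A `b`-th syzygy is invariant under isomorphism of the module resolved. -/
theorem of_equiv_right {b : ℕ} {Z W W' : ModuleCat.{0} S}
    (h : IsNthSyzygyOf S b Z W) (e : Nonempty (W ≃ₗ[S] W')) : IsNthSyzygyOf S b Z W' := by
  have h' : IsNthSyzygyOf S (0 + b) Z W' := add_iff.2 ⟨W, e, h⟩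
  rwa [zero_add] at h'

/-- If `Z` is both an `a`-th and an `(a + b)`-th syzygy of `M`, it is a `b`-th syzygy of itself. -/
theorem self_of_add {a b : ℕ} {Z M : ModuleCat.{0} S}
    (hab : IsNthSyzygyOf S (a + b) Z M) (ha : IsNthSyzygyOf S a Z M) :
    IsNthSyzygyOf S b Z Z := by
  obtain ⟨W, hW, hZ⟩ := add_iff.1 hab
  exact hZ.of_equiv_right (hW.nonempty_equiv ha ⟨LinearEquiv.refl S M⟩)

theorem self_mul {q : ℕ} {Z : ModuleCat.{0} S} (h : IsNthSyzygyOf S q Z Z) (k : ℕ) :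
    IsNthSyzygyOf S (q * k) Z Z := by
  induction k with
  | zero => exact ⟨LinearEquiv.refl S Z⟩
  | succ k ih => exact add_iff.2 ⟨Z, ih, h⟩

end IsNthSyzygyOf

namespace IsPeriodicWithPeriod

variable {S : Type} [Ring S] {Z : ModuleCat.{0} S} {q : ℕ}

theorem isNthSyzygyOf_self (hq : IsPeriodicWithPeriod S Z q) : IsNthSyzygyOf S q Z Z := by
  obtain ⟨-, ⟨W, hW, e⟩, -⟩ := hq
  exact hW.of_equiv e

/-- The period divides every `p` for which `Z` is its own `p`-th syzygy. -/
theorem dvd_of_isNthSyzygyOf_self (hq : IsPeriodicWithPeriod S Z q) {p : ℕ}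
    (hp : IsNthSyzygyOf S p Z Z) : q ∣ p := by
  rw [← Nat.div_add_mod p q] at hp
  have hr := hp.self_of_add (hq.isNthSyzygyOf_self.self_mul (p / q))
  by_contra hdvd
  have hpos : 0 < p % q := Nat.pos_of_ne_zero fun h => hdvd (Nat.dvd_of_mod_eq_zero h)
  exact (Nat.mod_lt p hq.1).not_ge (hq.2.2 _ hpos ⟨Z, hr, ⟨LinearEquiv.refl S Z⟩⟩)

end IsPeriodicWithPeriod

theorem statement_6 (R : Type) [Ring R] [IsArtinianRing R]
    (M : ModuleCat.{0} R) (hM : Module.Finite R M)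
    (m q : ℕ) (Z : ModuleCat.{0} R)
    (hZ : IsNthSyzygyOf R m Z M) (hZnt : Nontrivial Z)
    (hq : IsPeriodicWithPeriod R Z q)
    (j p : ℕ) (hp : 0 < p) (Z₁ Z₂ : ModuleCat.{0} R)
    (h₁ : IsNthSyzygyOf R (j + p) Z₁ M) (h₂ : IsNthSyzygyOf R j Z₂ M)
    (hiso : Nonempty (Z₁ ≃ₗ[R] Z₂)) :
    q ∣ p := by
  have hN : IsNthSyzygyOf R (m + q * j) Z M :=
    IsNthSyzygyOf.add_iff.2 ⟨Z, hZ, hq.isNthSyzygyOf_self.self_mul j⟩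
  obtain ⟨d, hd⟩ : ∃ d, m + q * j = j + d :=
    Nat.exists_eq_add_of_le ((Nat.le_mul_of_pos_left j hq.1).trans (Nat.le_add_left _ m))
  rw [hd] at hN
  obtain ⟨W, hW, hZW⟩ := IsNthSyzygyOf.add_iff.1 hN
  have hWZ₁ : Nonempty (W ≃ₗ[R] Z₁) :=
    hW.nonempty_equiv (h₂.of_equiv (hiso.map LinearEquiv.symm)) ⟨LinearEquiv.refl R M⟩
  have hNp : IsNthSyzygyOf R (j + p + d) Z M :=
    IsNthSyzygyOf.add_iff.2 ⟨Z₁, h₁, hZW.of_equiv_right hWZ₁⟩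
  rw [add_right_comm] at hNp
  exact hq.dvd_of_isNthSyzygyOf_self (hNp.self_of_add hN)
end
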